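/- For every real number ε > 0 there exists a natural number M(ε) with the following property: for every integer d ≥ M(ε) and every finite permutation group G ≤ Sym(Ω) of degree n = |Ω| with G lying in the class Γ_d, one has |G| ≤ ((1+ε)·d/e)^{n-1}, where e denotes Euler's number. -/

import Mathlib

open scoped Pointwise

/-- A group `H` has a *section* isomorphic to the alternating group `A_d`, i.e. there are
subgroups `K ⊴ L ≤ H` with `L/K ≅ A_d`; equivalently, there is a subgroup `L ≤ H` and a
surjective homomorphism from `L` onto `A_d`. -/
def HasAltSection (d : ℕ) (H : Type*) [Group H] : Prop :=
  ∃ (L : Subgroup H) (φ : ↥L →* alternatingGroup (Fin d)), Function.Surjective φ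

/-- The class `Γ_d`: groups with no section isomorphic to the alternating group `A_d`. -/
def InGamma (d : ℕ) (H : Type*) [Group H] : Prop := ¬ HasAltSection d H

/-- A permutation group `G ≤ Sym(Ω)` is primitive if it acts transitively on `Ω` and
every block of the action is trivial (i.e. it preserves no nontrivial partition of `Ω`). -/
def IsPrimitivePerm {Ω : Type*} (G : Subgroup (Equiv.Perm Ω)) : Prop :=
  MulAction.IsPretransitive G Ω ∧
    ∀ B : Set Ω, MulAction.IsBlock G B → MulAction.IsTrivialBlock B

/-- `G ≤ Sym(Ω)` has a base of size at most `k`: a subset of `Ω` of cardinality at most `k`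
whose pointwise stabilizer in `G` is trivial.  The base size `b(G)` is the least such `k`,
so `b(G) ≤ k` is expressed by `HasBaseOfSize G k`. -/
def HasBaseOfSize {Ω : Type*} (G : Subgroup (Equiv.Perm Ω)) (k : ℕ) : Prop :=
  ∃ S : Finset Ω, S.card ≤ k ∧ ∀ g ∈ G, (∀ α ∈ S, g α = α) → g = 1

/-- The pointwise stabilizer `G_(Δ) = ⋂_{α ∈ Δ} G_α` of a subset `Δ ⊆ Ω` in `G ≤ Sym(Ω)`,
as a subgroup of `G` (equal to `G` itself when `Δ` is empty). -/
def PointwiseStab {Ω : Type*} (G : Subgroup (Equiv.Perm Ω)) (Δ : Finset Ω) : Subgroup ↥G :=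
  ⨅ α ∈ Δ, MulAction.stabilizer (↥G) α

open MulAction Function

section Gamma

variable {d : ℕ} {H K : Type*} [Group H] [Group K]

theorem HasAltSection.of_surjective (f : H →* K) (hf : Surjective f) (h : HasAltSection d K) :
    HasAltSection d H := by
  obtain ⟨L, φ, hφ⟩ := h
  exact ⟨L.comap f, φ.comp (f.subgroupComap L),
    hφ.comp (f.subgroupComap_surjective_of_surjective L hf)⟩

theorem HasAltSection.of_injective (f : H →* K) (hf : Injective f) (h : HasAltSection d H) :
    HasAltSection d K := by
  obtain ⟨L, φ, hφ⟩ := h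
  exact ⟨L.map f, φ.comp (L.equivMapOfInjective f hf).symm.toMonoidHom,
    hφ.comp (L.equivMapOfInjective f hf).symm.surjective⟩

theorem InGamma.range (h : InGamma d H) (f : H →* K) : InGamma d f.range :=
  fun hs => h (hs.of_surjective f.rangeRestrict f.rangeRestrict_surjective)

theorem InGamma.subgroup (h : InGamma d H) (L : Subgroup H) : InGamma d L :=
  fun hs => h (hs.of_injective L.subtype L.subtype_injective)

theorem hasAltSection_of_injective_alternatingGroup (f : alternatingGroup (Fin d) →* H)
    (hf : Injective f) : HasAltSection d H :=
  HasAltSection.of_injective f hf ⟨⊤,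
    (Subgroup.topEquiv (G := alternatingGroup (Fin d))).toMonoidHom, Subgroup.topEquiv.surjective⟩

theorem hasAltSection_of_alternatingGroup_le {Ω : Type*} [Fintype Ω] [DecidableEq Ω]
    {G : Subgroup (Equiv.Perm Ω)} (hG : alternatingGroup Ω ≤ G) (hd : d ≤ Fintype.card Ω) :
    HasAltSection d G := by
  obtain ⟨ι⟩ : Nonempty (Fin d ↪ Ω) := Function.Embedding.nonempty_of_card_le (by simpa using hd)
  let e := Equiv.ofInjective ι ι.injective
  let f : alternatingGroup (Fin d) →* Equiv.Perm Ω :=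
    (Equiv.Perm.extendDomainHom e).comp (alternatingGroup (Fin d)).subtype
  have hf : ∀ g, f g ∈ G := fun g => hG <| by
    rw [Equiv.Perm.mem_alternatingGroup]
    change Equiv.Perm.sign ((g : Equiv.Perm (Fin d)).extendDomain e) = 1
    rw [Equiv.Perm.sign_extendDomain]
    exact g.2
  refine hasAltSection_of_injective_alternatingGroup (f.codRestrict G hf) ?_
  rw [MonoidHom.injective_codRestrict]
  exact (Equiv.Perm.extendDomainHom_injective e).comp Subtype.val_injective

end Gamma

/-- Permutation groups of degree `m` in `Γ_d` have order at most `x ^ (m - 1)`. -/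
def DegreeBound (d : ℕ) (x : ℝ) (m : ℕ) : Prop :=
  ∀ (Ω : Type) [Fintype Ω] (G : Subgroup (Equiv.Perm Ω)), Fintype.card Ω = m →
    InGamma d G → (Nat.card G : ℝ) ≤ x ^ (m - 1)

section Imprimitive

variable {d : ℕ} {x : ℝ}

theorem DegreeBound.card_range_le {H : Type*} [Group H] {X : Type} [Fintype X] (hH : InGamma d H)
    (hb : DegreeBound d x (Fintype.card X)) (f : H →* Equiv.Perm X) :
    (Nat.card f.range : ℝ) ≤ x ^ (Fintype.card X - 1) :=
  hb X f.range rfl (hH.range f)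

/-- The action on a fibre of an invariant function. -/
def fiberPermHom {Ω Q : Type*} (K : Subgroup (Equiv.Perm Ω)) (f : Ω → Q)
    (hf : ∀ k ∈ K, ∀ a, f (k a) = f a) (q : Q) : K →* Equiv.Perm {a // f a = q} where
  toFun k := (k : Equiv.Perm Ω).subtypePerm fun a => by rw [hf k k.2]
  map_one' := by ext; simp
  map_mul' _ _ := rfl

theorem card_le_of_invariant_fibers {Ω Q : Type} [Fintype Ω] [Fintype Q] [DecidableEq Q]
    {K : Subgroup (Equiv.Perm Ω)} (hK : InGamma d K) (f : Ω → Q) (hs : Surjective f)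
    (hf : ∀ k ∈ K, ∀ a, f (k a) = f a)
    (hb : ∀ q, DegreeBound d x (Fintype.card {a // f a = q})) :
    (Nat.card K : ℝ) ≤ x ^ (Fintype.card Ω - Fintype.card Q) := by
  classical
  let ψ : K →* (∀ q, (fiberPermHom K f hf q).range) :=
    MonoidHom.pi fun q => (fiberPermHom K f hf q).rangeRestrict
  have hψ : Injective ψ := by
    intro k l h
    ext a
    have h1 := congrArg Subtype.val (congrFun h (f a))
    exact congrArg Subtype.val (Equiv.congr_fun h1 ⟨a, rfl⟩)
  have hcard : Fintype.card Ω - Fintype.card Q = ∑ q, (Fintype.card {a // f a = q} - 1) := by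
    have h1 : Fintype.card Ω = ∑ q, Fintype.card {a // f a = q} := by
      rw [← Fintype.card_sigma]
      exact Fintype.card_congr (Equiv.sigmaFiberEquiv f).symm
    have h2 : ∀ q, 1 ≤ Fintype.card {a // f a = q} := fun q =>
      Fintype.card_pos_iff.2 ⟨⟨_, (hs q).choose_spec⟩⟩
    rw [Finset.sum_tsub_distrib _ fun q _ => h2 q, ← h1]
    simp
  calc (Nat.card K : ℝ) ≤ Nat.card (∀ q, (fiberPermHom K f hf q).range) := by
        exact_mod_cast Nat.card_le_card_of_injective ψ hψ
    _ = ∏ q, (Nat.card (fiberPermHom K f hf q).range : ℝ) := by rw [Nat.card_pi]; push_cast; rfl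
    _ ≤ ∏ q, x ^ (Fintype.card {a // f a = q} - 1) :=
        Finset.prod_le_prod (fun _ _ => Nat.cast_nonneg _) fun q _ => (hb q).card_range_le hK _
    _ = _ := by rw [Finset.prod_pow_eq_pow_sum, hcard]

/-- The action on the classes of an invariant equivalence relation. -/
def quotientPermHom {Ω : Type*} (G : Subgroup (Equiv.Perm Ω)) (s : Setoid Ω)
    (hs : ∀ g ∈ G, ∀ a b, s a b → s (g a) (g b)) : G →* Equiv.Perm (Quotient s) where
  toFun g :=
    { toFun := Quotient.map g (hs g g.2)
      invFun := Quotient.map (g⁻¹ : G) (hs _ (g⁻¹).2)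
      left_inv := by rintro ⟨a⟩; exact congrArg (Quotient.mk s) (by simp)
      right_inv := by rintro ⟨a⟩; exact congrArg (Quotient.mk s) (by simp) }
  map_one' := by ext ⟨a⟩; rfl
  map_mul' _ _ := by ext ⟨a⟩; rfl

theorem card_le_of_invariant_setoid (hx : 0 ≤ x) {Ω : Type} [Fintype Ω]
    {G : Subgroup (Equiv.Perm Ω)} (hG : InGamma d G)
    (hb : ∀ m < Fintype.card Ω, DegreeBound d x m) (s : Setoid Ω)
    (hs : ∀ g ∈ G, ∀ a b, s a b → s (g a) (g b)) (hbot : s ≠ ⊥) (htop : s ≠ ⊤) :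
    (Nat.card G : ℝ) ≤ x ^ (Fintype.card Ω - 1) := by
  classical
  have hsurj : Surjective (Quotient.mk s) := Quotient.mk_surjective
  have hQ : Fintype.card (Quotient s) < Fintype.card Ω := by
    refine Fintype.card_lt_of_surjective_not_injective _ hsurj fun hinj => hbot ?_
    refine Setoid.ext fun a b => ⟨fun h => hinj (Quotient.sound h), ?_⟩
    rintro rfl
    exact s.refl' a
  have hfib : ∀ q, Fintype.card {a // Quotient.mk s a = q} < Fintype.card Ω := by
    intro q
    by_contra! hq
    refine htop (Setoid.ext fun a b => ⟨fun _ => trivial, fun _ => ?_⟩)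
    have hall : ∀ a, Quotient.mk s a = q := by
      intro a
      by_contra ha
      exact hq.not_gt (Fintype.card_subtype_lt ha)
    exact Quotient.exact ((hall a).trans (hall b).symm)
  set φ := quotientPermHom G s hs
  have hker : (Nat.card φ.ker : ℝ) ≤ x ^ (Fintype.card Ω - Fintype.card (Quotient s)) := by
    have hcard : Nat.card φ.ker = Nat.card (φ.ker.map G.subtype) :=
      Nat.card_congr (φ.ker.equivMapOfInjective _ G.subtype_injective).toEquiv
    rw [hcard]
    refine card_le_of_invariant_fibers (f := Quotient.mk s) ?_ hsurj ?_ fun q => hb _ (hfib q)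
    · intro h
      exact hG.subgroup φ.ker (h.of_injective
        (φ.ker.equivMapOfInjective _ G.subtype_injective).symm.toMonoidHom
        (φ.ker.equivMapOfInjective _ G.subtype_injective).symm.injective)
    · rintro _ ⟨k, hk, rfl⟩ a
      exact Equiv.congr_fun (MonoidHom.mem_ker.1 hk) (Quotient.mk s a)
  have hpos : 0 < Fintype.card (Quotient s) := by
    rw [Fintype.card_pos_iff]
    obtain ⟨a, -⟩ : ∃ a : Ω, True := by
      by_contra! h
      exact hbot (Setoid.ext fun a => (h a).elim)
    exact ⟨Quotient.mk s a⟩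
  have hmul : Nat.card G = Nat.card φ.range * Nat.card φ.ker := by
    rw [← Subgroup.index_ker, Subgroup.index_mul_card]
  rw [hmul]
  push_cast
  calc (Nat.card φ.range : ℝ) * Nat.card φ.ker
      ≤ x ^ (Fintype.card (Quotient s) - 1) * x ^ (Fintype.card Ω - Fintype.card (Quotient s)) :=
        mul_le_mul ((hb _ hQ).card_range_le hG φ) hker (Nat.cast_nonneg _) (pow_nonneg hx _)
    _ = _ := by rw [← pow_add]; congr 1; omega

end Imprimitive

section Base

variable {Ω : Type*} {G : Subgroup (Equiv.Perm Ω)}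

/-- `S` is a base of `G`: its pointwise stabilizer is trivial. -/
def IsBase (G : Subgroup (Equiv.Perm Ω)) (S : Finset Ω) : Prop :=
  ∀ g ∈ G, (∀ a ∈ S, g a = a) → g = 1

theorem IsBase.card_le [Fintype Ω] {S : Finset Ω} (hS : IsBase G S) :
    Nat.card G ≤ Fintype.card Ω ^ S.card := by
  classical
  have hinj : Injective fun (g : G) (a : S) => (g : Equiv.Perm Ω) a := by
    intro g h hgh
    have h1 : (h⁻¹ * g : G) = 1 := by
      refine Subtype.ext (hS _ (h⁻¹ * g : G).2 fun a ha => ?_)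
      have h2 : (g : Equiv.Perm Ω) a = (h : Equiv.Perm Ω) a := congrFun hgh ⟨a, ha⟩
      simp [h2]
    exact (inv_mul_eq_one.1 h1).symm
  calc Nat.card G ≤ Nat.card (S → Ω) := Nat.card_le_card_of_injective _ hinj
    _ = _ := by simp

theorem isThreeCycle_commutator [Fintype Ω] [DecidableEq Ω] {g h : Equiv.Perm Ω} {b : Ω}
    (hg : g b ≠ b) (hh : h b ≠ b) (hgh : ∀ x, x ≠ b → g x = x ∨ h x = x) :
    (g * h * g⁻¹ * h⁻¹).IsThreeCycle := by
  have g1 : ∀ x, g x = x → g⁻¹ x = x := fun x hx => by rw [Equiv.Perm.inv_eq_iff_eq, hx]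
  have h1 : ∀ x, h x = x → h⁻¹ x = x := fun x hx => by rw [Equiv.Perm.inv_eq_iff_eq, hx]
  have ghb : g (h b) = h b := (hgh _ hh).resolve_right fun e => hh (h.injective e)
  have hgb : h (g b) = g b := (hgh _ hg).resolve_left fun e => hg (g.injective e)
  have gne : g⁻¹ b ≠ b := fun e => hg (Equiv.Perm.inv_eq_iff_eq.1 e).symm
  have hne : h⁻¹ b ≠ b := fun e => hh (Equiv.Perm.inv_eq_iff_eq.1 e).symm
  have hgib : h (g⁻¹ b) = g⁻¹ b := (hgh _ gne).resolve_left fun e => gne (by simpa using e.symm)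
  have ghib : g (h⁻¹ b) = h⁻¹ b := (hgh _ hne).resolve_right fun e => hne (by simpa using e.symm)
  have hgne : h b ≠ g b := fun e => hh (h.injective (by rw [e, hgb]))
  have key : g * h * g⁻¹ * h⁻¹ = Equiv.swap b (h b) * Equiv.swap b (g b) := by
    ext x
    simp only [Equiv.Perm.mul_apply]
    rcases eq_or_ne x b with rfl | hxb
    · rw [g1 _ ghib, Equiv.swap_apply_left, Equiv.swap_apply_of_ne_of_ne hg hgne.symm]
      simp
    rcases eq_or_ne x (g b) with rfl | hxg
    · rw [h1 _ hgb, Equiv.swap_apply_right, Equiv.swap_apply_left]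
      simp [ghb]
    rcases eq_or_ne x (h b) with rfl | hxh
    · rw [Equiv.swap_apply_of_ne_of_ne hxb hxg, Equiv.swap_apply_right]
      have e1 : h⁻¹ (h b) = b := by simp
      have e2 : g (g⁻¹ b) = b := by simp
      rw [e1, hgib, e2]
    rw [Equiv.swap_apply_of_ne_of_ne hxb hxg, Equiv.swap_apply_of_ne_of_ne hxb hxh]
    by_cases hx : h x = x
    · rw [h1 x hx]
      have hgx : g⁻¹ x ≠ b := fun e => hxg (Equiv.Perm.inv_eq_iff_eq.1 e)
      have : h (g⁻¹ x) = g⁻¹ x := by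
        rcases hgh _ hgx with e | e
        · have e' : x = g⁻¹ x := by simpa using e
          rw [← e', hx]
        · exact e
      rw [this]; simp
    · have hgx : g x = x := (hgh x hxb).resolve_right hx
      have hhx : h⁻¹ x ≠ b := fun e => hxh (Equiv.Perm.inv_eq_iff_eq.1 e)
      have : g (h⁻¹ x) = h⁻¹ x := (hgh _ hhx).resolve_right fun e => hx (by
        have e' : x = h⁻¹ x := by simpa using e
        rw [Equiv.Perm.eq_inv_iff_eq] at e'
        exact e')
      rw [g1 _ this]; simp [hgx]
  rw [key]
  exact Equiv.Perm.isThreeCycle_swap_mul_swap_same hh.symm hg.symm hgne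

/-- Bochert's theorem on bases of primitive groups. -/
theorem exists_isBase_two_mul_card_le [Fintype Ω] [DecidableEq Ω] (hG : IsPreprimitive G Ω)
    (hA : ¬ alternatingGroup Ω ≤ G) : ∃ S, IsBase G S ∧ 2 * S.card ≤ Fintype.card Ω := by
  classical
  have hex : ∃ k, ∃ S : Finset Ω, IsBase G S ∧ S.card = k :=
    ⟨_, Finset.univ, fun g _ h => Equiv.ext fun a => h a (Finset.mem_univ a), rfl⟩
  obtain ⟨S, hS, hcard⟩ := Nat.find_spec hex
  refine ⟨S, hS, ?_⟩
  by_contra! hlt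
  have hmin : ∀ T : Finset Ω, T.card < S.card → ¬ IsBase G T := fun T hT hb =>
    Nat.find_min hex (hcard ▸ hT) ⟨T, hb, rfl⟩
  have hc : Sᶜ.card < S.card := by rw [Finset.card_compl]; omega
  obtain ⟨g, hgG, hgfix, hg1⟩ : ∃ g ∈ G, (∀ a ∈ Sᶜ, g a = a) ∧ g ≠ 1 := by
    simpa [IsBase] using hmin _ hc
  obtain ⟨b, hb⟩ : ∃ b, g b ≠ b := by
    by_contra! h
    exact hg1 (Equiv.ext h)
  have hbS : b ∈ S := by
    by_contra h
    exact hb (hgfix b (Finset.mem_compl.2 h))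
  obtain ⟨h, hhG, hhfix, hh1⟩ : ∃ h ∈ G, (∀ a ∈ S.erase b, h a = a) ∧ h ≠ 1 := by
    have := hmin _ (Finset.card_erase_lt_of_mem hbS)
    simp only [IsBase] at this
    push Not at this
    exact this
  have hhb : h b ≠ b := fun e => hh1 <| hS h hhG fun a ha => by
    rcases eq_or_ne a b with rfl | hab
    · exact e
    · exact hhfix a (Finset.mem_erase.2 ⟨hab, ha⟩)
  refine hA (Equiv.Perm.alternatingGroup_le_of_isPreprimitive_of_isThreeCycle_mem hG
    (isThreeCycle_commutator hb hhb fun x hx => ?_)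
    (G.mul_mem (G.mul_mem (G.mul_mem hgG hhG) (G.inv_mem hgG)) (G.inv_mem hhG)))
  by_cases hxS : x ∈ S
  · exact Or.inr (hhfix x (Finset.mem_erase.2 ⟨hx, hxS⟩))
  · exact Or.inl (hgfix x (Finset.mem_compl.2 hxS))

end Base

section Chain

variable {Ω : Type} [Fintype Ω]

theorem exists_small_orbits_or_large_index (G : Subgroup (Equiv.Perm Ω))
    (hn : 2 ≤ Fintype.card Ω) (K : ℕ) :
    (∃ Δ : Finset Ω, Δ.card ≤ K ∧
      ∀ a : Ω, 2 * (orbit (fixingSubgroup G (Δ : Set Ω)) a).ncard ≤ Fintype.card Ω) ∨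
    ∃ Δ : Finset Ω, Δ.card = K ∧
      Fintype.card Ω ^ K ≤ (fixingSubgroup G (Δ : Set Ω)).index * 2 ^ K := by
  classical
  induction K with
  | zero =>
    refine Or.inr ⟨∅, rfl, ?_⟩
    simp
  | succ K ih =>
    obtain ⟨Δ, hΔ, h⟩ | ⟨Δ, hΔ, h⟩ := ih
    · exact Or.inl ⟨Δ, hΔ.trans K.le_succ, h⟩
    by_cases hsmall : ∀ a : Ω, 2 * (orbit (fixingSubgroup G (Δ : Set Ω)) a).ncard ≤ Fintype.card Ω
    · exact Or.inl ⟨Δ, hΔ.le.trans K.le_succ, hsmall⟩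
    push Not at hsmall
    obtain ⟨a, ha⟩ := hsmall
    set H := fixingSubgroup G (Δ : Set Ω) with hH
    have haΔ : a ∉ Δ := by
      intro haΔ
      have : orbit H a = {a} := by
        refine Set.eq_singleton_iff_unique_mem.2 ⟨mem_orbit_self a, ?_⟩
        rintro _ ⟨g, rfl⟩
        exact (mem_fixingSubgroup_iff G).1 g.2 a haΔ
      rw [this, Set.ncard_singleton] at ha
      omega
    refine Or.inr ⟨insert a Δ, by rw [Finset.card_insert_of_notMem haΔ, hΔ], ?_⟩
    have hfix : fixingSubgroup G ((insert a Δ : Finset Ω) : Set Ω) = H ⊓ stabilizer G a := by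
      ext g
      simp only [hH, Subgroup.mem_inf, mem_fixingSubgroup_iff, mem_stabilizer_iff,
        Finset.coe_insert, Set.mem_insert_iff, forall_eq_or_imp]
      tauto
    have hrel : (H ⊓ stabilizer G a).relIndex H = (orbit H a).ncard := by
      rw [← index_stabilizer, Subgroup.relIndex]
      congr 1
      ext g
      simp [Subgroup.mem_subgroupOf, mem_stabilizer_iff, Subgroup.smul_def]
    rw [hfix, ← Subgroup.relIndex_mul_index (inf_le_left : H ⊓ stabilizer G a ≤ H), hrel]
    calc Fintype.card Ω ^ (K + 1) = Fintype.card Ω ^ K * Fintype.card Ω := pow_succ _ _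
      _ ≤ (H.index * 2 ^ K) * (2 * (orbit H a).ncard) := Nat.mul_le_mul h ha.le
      _ = _ := by ring

theorem index_fixingSubgroup_le {d : ℕ} {x : ℝ} {G : Subgroup (Equiv.Perm Ω)}
    (hG : InGamma d G) (Δ : Finset Ω) (hb : DegreeBound d x Δ.card) :
    ((fixingSubgroup G (Δ : Set Ω)).index : ℝ) ≤
      x ^ (Δ.card - 1) * (Fintype.card Ω).choose Δ.card := by
  classical
  set S := stabilizer G (Δ : Set Ω)
  have hle : fixingSubgroup G (Δ : Set Ω) ≤ S := fixingSubgroup_le_stabilizer G (Δ : Set Ω)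
  have hrel : ((fixingSubgroup G (Δ : Set Ω)).relIndex S : ℝ) ≤ x ^ (Δ.card - 1) := by
    have hker : (fixingSubgroup G (Δ : Set Ω)).subgroupOf S =
        (toPermHom S (Δ : Set Ω)).ker := by
      ext g
      rw [Subgroup.mem_subgroupOf, mem_fixingSubgroup_iff, MonoidHom.mem_ker]
      constructor
      · intro h
        ext ⟨a, ha⟩
        exact h a ha
      · intro h a ha
        exact congrArg Subtype.val (Equiv.congr_fun h ⟨a, ha⟩)
    rw [Subgroup.relIndex, hker, Subgroup.index_ker]
    have hc : Fintype.card (Δ : Set Ω) = Δ.card := by simp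
    have := DegreeBound.card_range_le (hG.subgroup S) (X := (Δ : Set Ω)) (x := x)
      (by rwa [hc]) (toPermHom S (Δ : Set Ω))
    rwa [hc] at this
  have hidx : S.index ≤ (Fintype.card Ω).choose Δ.card := by
    rw [index_stabilizer]
    have hsub : orbit G (Δ : Set Ω) ⊆
        ((fun T : Finset Ω => (T : Set Ω)) ''
          ((Finset.univ.powersetCard Δ.card : Finset (Finset Ω)) : Set (Finset Ω))) := by
      rintro _ ⟨g, rfl⟩
      refine ⟨g • Δ, ?_, by simp⟩
      simp [Finset.mem_powersetCard]
    calc (orbit G (Δ : Set Ω)).ncard ≤ _ := Set.ncard_le_ncard hsub (Set.toFinite _)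
      _ ≤ _ := Set.ncard_image_le (Set.toFinite _)
      _ = _ := by rw [Set.ncard_coe_finset, Finset.card_powersetCard, Finset.card_univ]
  rw [← Subgroup.relIndex_mul_index hle]
  push_cast
  exact mul_le_mul hrel (by exact_mod_cast hidx) (Nat.cast_nonneg _)
    ((Nat.cast_nonneg _).trans hrel)

theorem exists_finset_small_orbits {d : ℕ} {x : ℝ} {G : Subgroup (Equiv.Perm Ω)}
    (hG : InGamma d G) (hn : 2 ≤ Fintype.card Ω) {K : ℕ} (hb : DegreeBound d x K)
    (hK : 2 ^ K * x ^ (K - 1) < K.factorial) :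
    ∃ Δ : Finset Ω, Δ.card ≤ K ∧
      ∀ a : Ω, 2 * (orbit (fixingSubgroup G (Δ : Set Ω)) a).ncard ≤ Fintype.card Ω := by
  refine (exists_small_orbits_or_large_index G hn K).resolve_right ?_
  rintro ⟨Δ, hΔ, h⟩
  have h1 := index_fixingSubgroup_le hG Δ (hΔ.symm ▸ hb)
  rw [hΔ] at h1
  have hnpos : (0 : ℝ) < (Fintype.card Ω : ℝ) ^ K := by
    have : (0 : ℝ) < Fintype.card Ω := by exact_mod_cast (by omega : 0 < Fintype.card Ω)
    positivity
  have hx : 0 ≤ x ^ (K - 1) := (Nat.cast_nonneg _).trans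
    ((hb (Fin K) ⊥ (by simp) fun hs => hG (hs.of_injective 1 fun a b _ => Subsingleton.elim a b)))
  have h2 : ((Fintype.card Ω : ℝ)) ^ K ≤
      (x ^ (K - 1) * (Fintype.card Ω).choose K) * 2 ^ K := by
    calc ((Fintype.card Ω : ℝ)) ^ K ≤ (fixingSubgroup G (Δ : Set Ω)).index * 2 ^ K := by
          exact_mod_cast h
      _ ≤ _ := by gcongr
  have h3 : ((Fintype.card Ω).choose K : ℝ) ≤ (Fintype.card Ω : ℝ) ^ K / K.factorial :=
    Nat.choose_le_pow_div K _
  have hf : (0 : ℝ) < K.factorial := by exact_mod_cast K.factorial_pos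
  have h4 : (Fintype.card Ω : ℝ) ^ K ≤
      (2 ^ K * x ^ (K - 1)) * ((Fintype.card Ω : ℝ) ^ K / K.factorial) := by
    calc _ ≤ (x ^ (K - 1) * (Fintype.card Ω).choose K) * 2 ^ K := h2
      _ = (2 ^ K * x ^ (K - 1)) * (Fintype.card Ω).choose K := by ring
      _ ≤ _ := by gcongr
  have h5 : (2 ^ K * x ^ (K - 1)) * ((Fintype.card Ω : ℝ) ^ K / K.factorial) <
      K.factorial * ((Fintype.card Ω : ℝ) ^ K / K.factorial) :=
    mul_lt_mul_of_pos_right hK (div_pos hnpos hf)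
  rw [mul_div_cancel₀ _ hf.ne'] at h5
  exact absurd (h4.trans_lt h5) (lt_irrefl _)

end Chain

section Separation

open scoped Classical

variable {Ω : Type*} [Fintype Ω] {G : Subgroup (Equiv.Perm Ω)} {r : Setoid Ω}

/-- The number of elements of `G` moving `a` and `b` to different classes of `r`. -/
noncomputable def sepCount (G : Subgroup (Equiv.Perm Ω)) (r : Setoid Ω) (a b : Ω) : ℕ :=
  (Finset.univ.filter fun g : G => ¬ r (g.1 a) (g.1 b)).card

theorem sepCount_apply (h : Equiv.Perm Ω) (hh : h ∈ G) (a b : Ω) :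
    sepCount G r (h a) (h b) = sepCount G r a b := by
  refine Finset.card_equiv (Equiv.mulRight (⟨h, hh⟩ : G)) fun g => ?_
  simp

theorem sepCount_comm (a b : Ω) : sepCount G r a b = sepCount G r b a := by
  unfold sepCount
  congr 1
  ext g
  simp [r.comm']

theorem sepCount_triangle (a b c : Ω) :
    sepCount G r a c ≤ sepCount G r a b + sepCount G r b c := by
  unfold sepCount
  refine (Finset.card_le_card ?_).trans (Finset.card_union_le _ _)
  intro g
  simp only [Finset.mem_filter, Finset.mem_univ, true_and, Finset.mem_union]
  intro h
  by_contra! h'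
  exact h (r.trans' h'.1 h'.2)

theorem sum_sepCount (P : Finset (Ω × Ω)) (hP : ∀ g ∈ G, ∀ p ∈ P, (g p.1, g p.2) ∈ P) :
    ∑ p ∈ P, sepCount G r p.1 p.2 = Nat.card G * (P.filter fun p => ¬ r p.1 p.2).card := by
  simp only [sepCount, Finset.card_filter]
  rw [Finset.sum_comm, Nat.card_eq_fintype_card, ← Finset.card_univ, ← smul_eq_mul,
    ← Finset.sum_const]
  refine Finset.sum_congr rfl fun g _ => ?_
  refine Finset.sum_bij' (fun p _ => (g.1 p.1, g.1 p.2)) (fun p _ => ((g⁻¹).1 p.1, (g⁻¹).1 p.2))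
    (fun p hp => hP g g.2 p hp) (fun p hp => hP _ (g⁻¹).2 p hp) ?_ ?_ ?_ <;> simp

theorem exists_separating_family {p : ℝ} (hp : p ≤ 1) {m : ℕ}
    (hm : (Fintype.card Ω : ℝ) ^ 2 * (1 - p) ^ m < 1) :
    ∃ f : Fin m → G, ∀ a b, p * Nat.card G ≤ sepCount G r a b →
      ∃ i, ¬ r ((f i).1 a) ((f i).1 b) := by
  by_contra! hcon
  let P : Finset (Ω × Ω) :=
    Finset.univ.filter fun q => p * Nat.card G ≤ sepCount G r q.1 q.2
  let B : Ω × Ω → Finset G := fun q => Finset.univ.filter fun g => r (g.1 q.1) (g.1 q.2)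
  have hB : ∀ q ∈ P, ((B q).card : ℝ) ≤ (1 - p) * Nat.card G := by
    intro q hq
    have h1 : (B q).card + sepCount G r q.1 q.2 = Nat.card G := by
      rw [Nat.card_eq_fintype_card, ← Finset.card_univ]
      exact Finset.card_filter_add_card_filter_not _
    have h2 := (Finset.mem_filter.1 hq).2
    have h3 : ((B q).card : ℝ) + sepCount G r q.1 q.2 = Nat.card G := by exact_mod_cast h1
    linarith
  have hcover : (Finset.univ : Finset (Fin m → G)) ⊆
      P.biUnion fun q => Fintype.piFinset fun _ => B q := by
    intro f _
    obtain ⟨a, b, hab, h⟩ := hcon f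
    refine Finset.mem_biUnion.2 ⟨(a, b), Finset.mem_filter.2 ⟨Finset.mem_univ _, hab⟩, ?_⟩
    simpa [B, Fintype.mem_piFinset] using h
  have hpos : (0 : ℝ) < (Nat.card G : ℝ) ^ m := by
    have : (0 : ℝ) < Nat.card G := by exact_mod_cast Nat.card_pos
    positivity
  have h1 : (Nat.card G : ℝ) ^ m ≤ ∑ q ∈ P, ((B q).card : ℝ) ^ m := by
    have := (Finset.card_le_card hcover).trans Finset.card_biUnion_le
    simp only [Finset.card_univ, Fintype.card_pi, Finset.prod_const, Fintype.card_fin,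
      Fintype.card_piFinset] at this
    rw [Nat.card_eq_fintype_card]
    exact_mod_cast this
  have h2 : ∑ q ∈ P, ((B q).card : ℝ) ^ m ≤
      (Fintype.card Ω : ℝ) ^ 2 * ((1 - p) * Nat.card G) ^ m := by
    calc ∑ q ∈ P, ((B q).card : ℝ) ^ m ≤ ∑ q ∈ P, ((1 - p) * Nat.card G) ^ m :=
          Finset.sum_le_sum fun q hq => pow_le_pow_left₀ (Nat.cast_nonneg _) (hB q hq) _
      _ = P.card * ((1 - p) * Nat.card G) ^ m := by rw [Finset.sum_const, nsmul_eq_mul]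
      _ ≤ _ := by
        have h3 : 0 ≤ 1 - p := by linarith
        have h4 : (P.card : ℝ) ≤ (Fintype.card Ω : ℝ) ^ 2 := by
          have := Finset.card_le_univ P
          rw [Fintype.card_prod, ← sq] at this
          exact_mod_cast this
        gcongr
  rw [mul_pow, ← mul_assoc] at h2
  nlinarith

theorem exists_separating_finset {p : ℝ} (hp : p ≤ 1) {m : ℕ}
    (hm : (Fintype.card Ω : ℝ) ^ 2 * (1 - p) ^ m < 1) (Δ : Finset Ω) :
    ∃ S : Finset Ω, S.card ≤ m * Δ.card ∧ ∀ g ∈ G, (∀ s ∈ S, g s = s) → ∀ a,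
      (sepCount G (orbitRel (fixingSubgroup G (Δ : Set Ω)) Ω) a (g a) : ℝ) < p * Nat.card G := by
  obtain ⟨f, hf⟩ := exists_separating_family (G := G)
    (r := orbitRel (fixingSubgroup G (Δ : Set Ω)) Ω) hp hm
  refine ⟨Finset.univ.biUnion fun i => Δ.image fun x => ((f i)⁻¹).1 x, ?_, ?_⟩
  · calc _ ≤ ∑ i : Fin m, (Δ.image fun x => ((f i)⁻¹).1 x).card := Finset.card_biUnion_le
      _ ≤ ∑ _i : Fin m, Δ.card := Finset.sum_le_sum fun _ _ => Finset.card_image_le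
      _ = _ := by simp
  · intro g hg hS a
    by_contra! hsep
    obtain ⟨i, hi⟩ := hf _ _ hsep
    refine hi (Setoid.symm' _ ?_)
    have hmem : f i * ⟨g, hg⟩ * (f i)⁻¹ ∈ fixingSubgroup G (Δ : Set Ω) := by
      rw [mem_fixingSubgroup_iff]
      intro x hx
      have h1 := hS (((f i)⁻¹).1 x) (Finset.mem_biUnion.2
        ⟨i, Finset.mem_univ i, Finset.mem_image_of_mem _ hx⟩)
      change (f i).1 (g (((f i)⁻¹).1 x)) = x
      rw [h1]
      simp
    refine ⟨⟨_, hmem⟩, ?_⟩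
    change (f i).1 (g (((f i)⁻¹).1 ((f i).1 a))) = (f i).1 (g a)
    simp

end Separation

section Distance

variable {V : Type*} {Γ : SimpleGraph V}

theorem SimpleGraph.Connected.exists_adj_dist_lt (hΓ : Γ.Connected) {u w : V} (h : u ≠ w) :
    ∃ z, Γ.Adj u z ∧ Γ.dist z w < Γ.dist u w := by
  obtain ⟨p, hp⟩ := hΓ.exists_walk_length_eq_dist u w
  cases p with
  | nil => exact absurd rfl h
  | cons hadj q =>
    refine ⟨_, hadj, ?_⟩
    rw [← hp, SimpleGraph.Walk.length_cons]
    exact Nat.lt_succ_of_le (SimpleGraph.dist_le q)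

theorem SimpleGraph.Connected.dist_le_succ_of_adj (hΓ : Γ.Connected) {u z : V}
    (h : Γ.Adj u z) (w : V) : Γ.dist u w ≤ Γ.dist z w + 1 := by
  have h1 := hΓ.dist_triangle (u := u) (v := z) (w := w)
  rw [SimpleGraph.dist_eq_one_iff_adj.2 h] at h1
  omega

theorem SimpleGraph.Connected.exists_dist_eq (hΓ : Γ.Connected) (u w : V) {j : ℕ}
    (hj : j ≤ Γ.dist w u) : ∃ z, Γ.dist z u = j := by
  induction hj using Nat.decreasingInduction with
  | self => exact ⟨w, rfl⟩
  | of_succ k hk ih =>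
    obtain ⟨z, hz⟩ := ih
    have hne : z ≠ u := by
      rintro rfl
      simp at hz
    obtain ⟨y, hy, hlt⟩ := hΓ.exists_adj_dist_lt hne
    have := hΓ.dist_le_succ_of_adj hy u
    exact ⟨y, by omega⟩

open scoped Classical in
/-- In a connected graph of minimal degree at least `v`, distances are at most `3n / v`. -/
theorem SimpleGraph.Connected.dist_mul_le [Fintype V] (hΓ : Γ.Connected) {v : ℕ}
    (hv : ∀ u, v ≤ (Finset.univ.filter (Γ.Adj u)).card) (w u : V) :
    Γ.dist w u * v ≤ 3 * Fintype.card V := by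
  have hex : ∀ j : ℕ, ∃ z, j ≤ Γ.dist w u → Γ.dist z u = j := by
    intro j
    by_cases hj : j ≤ Γ.dist w u
    · obtain ⟨z, hz⟩ := hΓ.exists_dist_eq u w hj
      exact ⟨z, fun _ => hz⟩
    · exact ⟨u, fun h => absurd h hj⟩
  choose z hz using hex
  have hcol : ∀ y, ((Finset.range (Γ.dist w u)).filter fun j => Γ.Adj (z j) y).card ≤ 3 := by
    intro y
    calc _ ≤ (Finset.Icc (Γ.dist y u - 1) (Γ.dist y u + 1)).card := by
          refine Finset.card_le_card fun j hj => ?_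
          obtain ⟨hj1, hj2⟩ := Finset.mem_filter.1 hj
          have h0 := hz j (Finset.mem_range.1 hj1).le
          have h1 := hΓ.dist_le_succ_of_adj hj2 u
          have h2 := hΓ.dist_le_succ_of_adj hj2.symm u
          rw [Finset.mem_Icc]
          omega
      _ ≤ 3 := by rw [Nat.card_Icc]; omega
  calc Γ.dist w u * v = ∑ _j ∈ Finset.range (Γ.dist w u), v := by simp
    _ ≤ ∑ j ∈ Finset.range (Γ.dist w u), (Finset.univ.filter (Γ.Adj (z j))).card :=
        Finset.sum_le_sum fun j _ => hv _
    _ = ∑ y, ((Finset.range (Γ.dist w u)).filter fun j => Γ.Adj (z j) y).card := by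
        simp only [Finset.card_filter]
        exact Finset.sum_comm
    _ ≤ ∑ _y : V, 3 := Finset.sum_le_sum fun y _ => hcol y
    _ = _ := by simp [mul_comm]

end Distance

/-- No nontrivial equivalence relation is invariant under `G`. -/
def HasNoInvariantSetoid {Ω : Type*} (G : Subgroup (Equiv.Perm Ω)) : Prop :=
  ∀ s : Setoid Ω, (∀ g ∈ G, ∀ a b, s a b → s (g a) (g b)) → s = ⊥ ∨ s = ⊤

/-- The undirected orbital graph of the pair `(a, b)`. -/
def orbitalGraph {Ω : Type*} (G : Subgroup (Equiv.Perm Ω)) (a b : Ω) (hab : a ≠ b) :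
    SimpleGraph Ω where
  Adj u w := ∃ g ∈ G, (u = g a ∧ w = g b) ∨ (u = g b ∧ w = g a)
  symm := ⟨fun u w ⟨g, hg, h⟩ => ⟨g, hg, h.symm.imp And.symm And.symm⟩⟩
  loopless := ⟨fun u ⟨g, hg, h⟩ => by
    rcases h with ⟨h1, h2⟩ | ⟨h1, h2⟩
    · exact hab (g.injective (h1.symm.trans h2))
    · exact hab (g.injective (h2.symm.trans h1))⟩

section Orbital

open scoped Classical

variable {Ω : Type*} {G : Subgroup (Equiv.Perm Ω)} {a b : Ω} {hab : a ≠ b}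

theorem orbitalGraph_adj_apply {g : Equiv.Perm Ω} (hg : g ∈ G) {u w : Ω}
    (h : (orbitalGraph G a b hab).Adj u w) : (orbitalGraph G a b hab).Adj (g u) (g w) := by
  obtain ⟨k, hk, h⟩ := h
  refine ⟨g * k, G.mul_mem hg hk, ?_⟩
  rcases h with ⟨rfl, rfl⟩ | ⟨rfl, rfl⟩
  · exact Or.inl ⟨rfl, rfl⟩
  · exact Or.inr ⟨rfl, rfl⟩

/-- The action of `g ∈ G` on an orbital graph of `G`. -/
def orbitalGraphHom {g : Equiv.Perm Ω} (hg : g ∈ G) :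
    orbitalGraph G a b hab →g orbitalGraph G a b hab where
  toFun := g
  map_rel' h := orbitalGraph_adj_apply hg h

theorem orbitalGraph_connected (hG : HasNoInvariantSetoid G) :
    (orbitalGraph G a b hab).Connected := by
  have hadj : (orbitalGraph G a b hab).Adj a b := ⟨1, G.one_mem, Or.inl ⟨rfl, rfl⟩⟩
  have h := hG (orbitalGraph G a b hab).reachableSetoid
    fun g hg u w h => SimpleGraph.Reachable.map (orbitalGraphHom hg) h
  have : Nonempty Ω := ⟨a⟩
  refine ⟨fun u w => ?_⟩
  rcases h with h | h
  · have h1 : (orbitalGraph G a b hab).reachableSetoid a b := hadj.reachable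
    rw [h] at h1
    exact absurd h1 hab
  · have h1 : (⊤ : Setoid Ω) u w := trivial
    rw [← h] at h1
    exact h1

theorem orbitalGraph_dist_apply (hG : HasNoInvariantSetoid G) {g : Equiv.Perm Ω} (hg : g ∈ G)
    (u w : Ω) :
    (orbitalGraph G a b hab).dist (g u) (g w) = (orbitalGraph G a b hab).dist u w := by
  have hle : ∀ g ∈ G, ∀ u w,
      (orbitalGraph G a b hab).dist (g u) (g w) ≤ (orbitalGraph G a b hab).dist u w := by
    intro g hg u w
    obtain ⟨p, hp⟩ := (orbitalGraph_connected hG).exists_walk_length_eq_dist u w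
    rw [← hp, ← SimpleGraph.Walk.length_map (orbitalGraphHom hg) p]
    exact SimpleGraph.dist_le _
  refine le_antisymm (hle g hg u w) ?_
  simpa using hle g⁻¹ (G.inv_mem hg) (g u) (g w)

variable [Fintype Ω]

/-- The valency of an orbital graph at its base vertex. -/
noncomputable def orbitalDegree (G : Subgroup (Equiv.Perm Ω)) (a b : Ω) (hab : a ≠ b) : ℕ :=
  (Finset.univ.filter ((orbitalGraph G a b hab).Adj a)).card

theorem card_filter_adj_eq [IsPretransitive G Ω] (u : Ω) :
    (Finset.univ.filter ((orbitalGraph G a b hab).Adj u)).card = orbitalDegree G a b hab := by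
  obtain ⟨g, rfl⟩ := exists_smul_eq G a u
  refine (Finset.card_equiv g.1 fun w => ?_).symm
  simp only [Finset.mem_filter, Finset.mem_univ, true_and]
  refine ⟨fun h => orbitalGraph_adj_apply g.2 h, fun h => ?_⟩
  have := orbitalGraph_adj_apply (G.inv_mem g.2) h
  change (orbitalGraph G a b hab).Adj (g.1⁻¹ (g.1 a)) (g.1⁻¹ (g.1 w)) at this
  simpa using this

theorem sepCount_eq_of_adj {r : Setoid Ω} {u w : Ω} (h : (orbitalGraph G a b hab).Adj u w) :
    sepCount G r u w = sepCount G r a b := by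
  obtain ⟨g, hg, ⟨rfl, rfl⟩ | ⟨rfl, rfl⟩⟩ := h
  · exact sepCount_apply g hg a b
  · rw [sepCount_apply g hg, sepCount_comm]

theorem sepCount_le_dist_mul (hG : HasNoInvariantSetoid G) (r : Setoid Ω) (u w : Ω) :
    sepCount G r u w ≤ (orbitalGraph G a b hab).dist u w * sepCount G r a b := by
  have hwalk : ∀ {u w : Ω} (p : (orbitalGraph G a b hab).Walk u w),
      sepCount G r u w ≤ p.length * sepCount G r a b := by
    intro u w p
    induction p with
    | nil => simp [sepCount]
    | @cons x y z hadj q ih =>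
      have h1 := sepCount_triangle (G := G) (r := r) x y z
      rw [sepCount_eq_of_adj hadj] at h1
      rw [SimpleGraph.Walk.length_cons, add_mul, one_mul]
      omega
  obtain ⟨p, hp⟩ := (orbitalGraph_connected (hab := hab) hG).exists_walk_length_eq_dist u w
  exact hp ▸ hwalk p

/-- Pairs of small orbital valency are separated often by a single point. -/
theorem card_le_two_mul_degree_mul_sepCount [IsPretransitive G Ω] (hG : HasNoInvariantSetoid G)
    (c : Ω) (hab : a ≠ b) :
    Nat.card G ≤ 2 * orbitalDegree G a b hab *
      sepCount G (orbitRel (fixingSubgroup G (({c} : Finset Ω) : Set Ω)) Ω) a b := by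
  set r := orbitRel (fixingSubgroup G (({c} : Finset Ω) : Set Ω)) Ω with hr
  set Γ := orbitalGraph G a b hab with hΓ
  have hconn : Γ.Connected := orbitalGraph_connected hG
  have hdist : ∀ u w, r u w → Γ.dist u c = Γ.dist w c := by
    rintro _ w ⟨g, rfl⟩
    have hgc : g.1.1 c = c := (mem_fixingSubgroup_iff G).1 g.2 c (by simp)
    have h1 := orbitalGraph_dist_apply (hab := hab) hG g.1.2 w c
    rwa [hgc] at h1
  let P : Finset (Ω × Ω) := Finset.univ.filter fun p => Γ.Adj p.1 p.2
  have hsum := sum_sepCount (G := G) (r := r) P fun g hg p hp =>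
    Finset.mem_filter.2 ⟨Finset.mem_univ _, orbitalGraph_adj_apply hg (Finset.mem_filter.1 hp).2⟩
  have hconst : ∑ p ∈ P, sepCount G r p.1 p.2 = P.card * sepCount G r a b := by
    rw [← smul_eq_mul, ← Finset.sum_const]
    exact Finset.sum_congr rfl fun p hp => sepCount_eq_of_adj (Finset.mem_filter.1 hp).2
  have hP : P.card = Fintype.card Ω * orbitalDegree G a b hab := by
    simp only [P, Finset.card_filter]
    rw [Fintype.sum_prod_type]
    simp only [← Finset.card_filter]
    rw [Finset.sum_congr rfl fun u _ => card_filter_adj_eq u]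
    simp
  have hcross : Fintype.card Ω - 1 ≤ (P.filter fun p => ¬ r p.1 p.2).card := by
    have hex : ∀ u, ∃ z, u ≠ c → Γ.Adj u z ∧ Γ.dist z c < Γ.dist u c := by
      intro u
      by_cases hu : u = c
      · exact ⟨u, fun h => absurd hu h⟩
      · obtain ⟨z, hz⟩ := hconn.exists_adj_dist_lt hu
        exact ⟨z, fun _ => hz⟩
    choose z hz using hex
    rw [← Finset.card_univ, ← Finset.card_erase_of_mem (Finset.mem_univ c)]
    refine Finset.card_le_card_of_injOn (fun u => (u, z u)) (fun u hu => ?_)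
      fun u _ w _ h => congrArg Prod.fst h
    have hu' := hz u (Finset.mem_erase.1 hu).1
    refine Finset.mem_filter.2 ⟨Finset.mem_filter.2 ⟨Finset.mem_univ _, hu'.1⟩, fun h => ?_⟩
    exact hu'.2.ne' (hdist _ _ h)
  have hn : 2 ≤ Fintype.card Ω := by
    have : Nontrivial Ω := ⟨a, b, hab⟩
    exact Fintype.one_lt_card
  have h1 : Nat.card G * (Fintype.card Ω - 1) ≤
      Fintype.card Ω * (orbitalDegree G a b hab * sepCount G r a b) := by
    rw [← mul_assoc, ← hP, ← hconst, hsum]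
    exact Nat.mul_le_mul_left _ hcross
  have h2 : Fintype.card Ω ≤ 2 * (Fintype.card Ω - 1) := by omega
  have h3 : Nat.card G * (Fintype.card Ω - 1) ≤
      (2 * orbitalDegree G a b hab * sepCount G r a b) * (Fintype.card Ω - 1) :=
    calc _ ≤ _ := h1
      _ ≤ (2 * (Fintype.card Ω - 1)) * (orbitalDegree G a b hab * sepCount G r a b) :=
        Nat.mul_le_mul_right _ h2
      _ = _ := by ring
  exact Nat.le_of_mul_le_mul_right h3 (by omega)

/-- Pairs of large orbital valency are separated often by a set whose pointwise stabilizer has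
only small orbits. -/
theorem card_mul_degree_le_sepCount [IsPretransitive G Ω] (hG : HasNoInvariantSetoid G)
    (hab : a ≠ b) {Δ : Finset Ω} (hΔ : ∀ x : Ω,
      2 * (orbit (fixingSubgroup G (Δ : Set Ω)) x).ncard ≤ Fintype.card Ω) :
    Nat.card G * orbitalDegree G a b hab ≤ 6 * Fintype.card Ω *
      sepCount G (orbitRel (fixingSubgroup G (Δ : Set Ω)) Ω) a b := by
  set r := orbitRel (fixingSubgroup G (Δ : Set Ω)) Ω with hr
  set n := Fintype.card Ω with hn
  have hsum := sum_sepCount (G := G) (r := r) Finset.univ fun g hg p _ => Finset.mem_univ _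
  have hrow : ∀ u : Ω, n ≤ 2 * (Finset.univ.filter fun w => ¬ r u w).card := by
    intro u
    have h1 := Finset.card_filter_add_card_filter_not (s := (Finset.univ : Finset Ω))
      (fun w => r u w)
    have h2 : (Finset.univ.filter fun w => r u w).card =
        (orbit (fixingSubgroup G (Δ : Set Ω)) u).ncard := by
      rw [← Set.ncard_coe_finset]
      congr 1
      ext w
      simp only [Finset.coe_filter, Finset.mem_univ, true_and, Set.mem_ofPred_eq]
      rw [r.comm', hr, orbitRel_apply]
    have h3 := hΔ u
    rw [Finset.card_univ] at h1
    omega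
  have htot : n * n ≤ 2 * ((Finset.univ : Finset (Ω × Ω)).filter fun p => ¬ r p.1 p.2).card := by
    rw [Finset.card_filter, Fintype.sum_prod_type, Finset.mul_sum]
    simp only [← Finset.card_filter]
    calc n * n = ∑ _u : Ω, n := by simp [hn]
      _ ≤ _ := Finset.sum_le_sum fun u _ => hrow u
  obtain ⟨⟨u, w⟩, huw⟩ : ∃ p : Ω × Ω, Nat.card G ≤ 2 * sepCount G r p.1 p.2 := by
    by_contra! hlt
    have hne : (Finset.univ : Finset (Ω × Ω)).Nonempty := ⟨(a, b), Finset.mem_univ _⟩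
    have h1 : ∑ p : Ω × Ω, 2 * sepCount G r p.1 p.2 < ∑ _p : Ω × Ω, Nat.card G :=
      Finset.sum_lt_sum_of_nonempty hne fun p _ => hlt p
    rw [← Finset.mul_sum, hsum, Finset.sum_const, Finset.card_univ, Fintype.card_prod,
      smul_eq_mul, ← hn] at h1
    have h2 := Nat.mul_le_mul_left (Nat.card G) htot
    linarith
  have h1 := sepCount_le_dist_mul (hab := hab) hG r u w
  have h2 := (orbitalGraph_connected (hab := hab) hG).dist_mul_le
    (fun u => (card_filter_adj_eq (hab := hab) u).ge) u w
  calc Nat.card G * orbitalDegree G a b hab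
      ≤ (2 * ((orbitalGraph G a b hab).dist u w * sepCount G r a b)) * orbitalDegree G a b hab :=
        Nat.mul_le_mul_right _ (huw.trans (Nat.mul_le_mul_left _ h1))
    _ = 2 * sepCount G r a b * ((orbitalGraph G a b hab).dist u w * orbitalDegree G a b hab) := by
        ring
    _ ≤ 2 * sepCount G r a b * (3 * n) := Nat.mul_le_mul_left _ h2
    _ = _ := by ring

end Orbital

section Primitivity

variable {Ω : Type*} {G : Subgroup (Equiv.Perm Ω)}

theorem isPretransitive_of_hasNoInvariantSetoid (hG : HasNoInvariantSetoid G) (h1 : G ≠ ⊥) :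
    IsPretransitive G Ω := by
  have h := hG (orbitRel G Ω) ?_
  · rcases h with h | h
    · refine absurd ((Subgroup.eq_bot_iff_forall G).2 fun g hg => Equiv.ext fun a => ?_) h1
      have h2 : orbitRel G Ω (g a) a := ⟨⟨g, hg⟩, rfl⟩
      rw [h] at h2
      exact h2
    · refine ⟨fun a b => ?_⟩
      have h2 : (⊤ : Setoid Ω) b a := trivial
      rw [← h] at h2
      exact h2
  · rintro g hg _ b ⟨k, rfl⟩
    refine ⟨⟨g, hg⟩ * k * ⟨g, hg⟩⁻¹, ?_⟩
    change g (k.1 (g⁻¹ (g b))) = g (k.1 b)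
    simp

theorem isPreprimitive_of_hasNoInvariantSetoid (hG : HasNoInvariantSetoid G) (h1 : G ≠ ⊥) :
    IsPreprimitive G Ω := by
  have := isPretransitive_of_hasNoInvariantSetoid hG h1
  refine ⟨fun {B} hB => ?_⟩
  by_contra hne
  rw [IsTrivialBlock, not_or, Set.not_subsingleton_iff] at hne
  obtain ⟨⟨a, ha, b, hb, hab⟩, huniv⟩ := hne
  obtain ⟨c, hc⟩ := (Set.ne_univ_iff_exists_notMem B).1 huniv
  let s : Setoid Ω :=
    { r := fun u w => ∀ g : G, u ∈ g • B ↔ w ∈ g • B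
      iseqv := ⟨fun _ _ => Iff.rfl, fun h g => (h g).symm, fun h h' g => (h g).trans (h' g)⟩ }
  have hs := hG s fun g hg u w h k => by
    have h2 := h (⟨g, hg⟩⁻¹ * k)
    simp only [mul_smul, Set.mem_inv_smul_set_iff] at h2
    exact h2
  have hsab : s a b := fun g => by
    rcases isBlock_iff_smul_eq_or_disjoint.1 hB g with h | h
    · rw [h]
      exact iff_of_true ha hb
    · exact iff_of_false (fun h' => Set.disjoint_left.1 h h' ha)
        fun h' => Set.disjoint_left.1 h h' hb
  rcases hs with h | h
  · rw [h] at hsab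
    exact hab hsab
  · have hac : (⊤ : Setoid Ω) a c := trivial
    rw [← h] at hac
    have := (hac 1)
    rw [one_smul] at this
    exact hc (this.1 ha)

end Primitivity

section Bounds

variable {Ω : Type} [Fintype Ω] {G : Subgroup (Equiv.Perm Ω)}

theorem exists_isBase_card_le [IsPretransitive G Ω] (hG : HasNoInvariantSetoid G)
    (hn : 2 ≤ Fintype.card Ω) {Δ : Finset Ω}
    (hΔ : ∀ a : Ω, 2 * (orbit (fixingSubgroup G (Δ : Set Ω)) a).ncard ≤ Fintype.card Ω)
    {v : ℝ} (hv : 1 ≤ v) (hvn : v ≤ Fintype.card Ω) {k l : ℕ}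
    (hk : (Fintype.card Ω : ℝ) ^ 2 * (1 - 1 / (2 * v)) ^ k < 1)
    (hl : (Fintype.card Ω : ℝ) ^ 2 * (1 - v / (6 * Fintype.card Ω)) ^ l < 1) :
    ∃ S, IsBase G S ∧ S.card ≤ k + l * Δ.card := by
  classical
  have hn0 : (0 : ℝ) < Fintype.card Ω := by exact_mod_cast (by omega : 0 < Fintype.card Ω)
  obtain ⟨c⟩ : Nonempty Ω := Fintype.card_pos_iff.1 (by omega)
  have hp : 1 / (2 * v) ≤ 1 := by rw [div_le_one (by linarith)]; linarith
  have hq : v / (6 * Fintype.card Ω) ≤ 1 := by rw [div_le_one (by linarith)]; linarith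
  obtain ⟨S, hS, hSsep⟩ := exists_separating_finset (G := G) hp hk {c}
  obtain ⟨T, hT, hTsep⟩ := exists_separating_finset (G := G) hq hl Δ
  refine ⟨S ∪ T, fun g hg hfix => ?_, ?_⟩
  · by_contra hg1
    obtain ⟨a, ha⟩ : ∃ a, g a ≠ a := by
      by_contra! h
      exact hg1 (Equiv.ext h)
    have h1 := hSsep g hg (fun s hs => hfix s (Finset.mem_union_left _ hs)) a
    have h2 := hTsep g hg (fun s hs => hfix s (Finset.mem_union_right _ hs)) a
    have h3 := card_le_two_mul_degree_mul_sepCount hG c ha.symm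
    have h4 := card_mul_degree_le_sepCount hG ha.symm hΔ
    set D := orbitalDegree G a (g a) ha.symm
    have hG0 : (0 : ℝ) < Nat.card G := by exact_mod_cast Nat.card_pos
    have hD0 : (0 : ℝ) < D := by
      rcases Nat.eq_zero_or_pos D with h | h
      · rw [h] at h3
        exact absurd h3 (by simp)
      · exact_mod_cast h
    have h3' : (Nat.card G : ℝ) ≤ 2 * D *
        sepCount G (orbitRel (fixingSubgroup G (({c} : Finset Ω) : Set Ω)) Ω) a (g a) := by
      exact_mod_cast h3
    have h4' : (Nat.card G : ℝ) * D ≤ 6 * Fintype.card Ω *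
        sepCount G (orbitRel (fixingSubgroup G (Δ : Set Ω)) Ω) a (g a) := by
      exact_mod_cast h4
    have h5 : (Nat.card G : ℝ) < 2 * D * (1 / (2 * v) * Nat.card G) :=
      h3'.trans_lt (mul_lt_mul_of_pos_left h1 (by positivity))
    have h6 : (Nat.card G : ℝ) * D <
        6 * Fintype.card Ω * (v / (6 * Fintype.card Ω) * Nat.card G) :=
      h4'.trans_lt (mul_lt_mul_of_pos_left h2 (by positivity))
    have h7 : 2 * (D : ℝ) * (1 / (2 * v) * Nat.card G) = D * Nat.card G / v := by
      field_simp
    have h8 : 6 * (Fintype.card Ω : ℝ) * (v / (6 * Fintype.card Ω) * Nat.card G) =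
        Nat.card G * v := by
      field_simp
    rw [h7, lt_div_iff₀ (by linarith)] at h5
    rw [h8] at h6
    linarith
  · refine (Finset.card_union_le _ _).trans ?_
    simp only [Finset.card_singleton, mul_one] at hS
    omega

/-- The inductive argument: the orders of all permutation groups in `Γ_d` are bounded, given
numerical estimates covering small, medium and large degrees. -/
theorem degreeBound_of_estimates {d : ℕ} {x : ℝ} (hx : 1 ≤ x) (hd : 2 ≤ d)
    (hsmall : ∀ n < d, (n.factorial : ℝ) ≤ x ^ (n - 1))
    (hmid : ∀ n, d ≤ n → n ^ 2 ≤ d ^ 3 → ∀ s, 2 * s ≤ n → (n : ℝ) ^ s ≤ x ^ (n - 1))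
    {K : ℕ} (hK : 2 ^ K * x ^ (K - 1) < K.factorial)
    (hlarge : ∀ n, d ≤ n → d ^ 3 < n ^ 2 → K < n ∧ ∃ (v : ℝ) (k l : ℕ), 1 ≤ v ∧ v ≤ n ∧
      (n : ℝ) ^ 2 * (1 - 1 / (2 * v)) ^ k < 1 ∧ (n : ℝ) ^ 2 * (1 - v / (6 * n)) ^ l < 1 ∧
      (n : ℝ) ^ (k + l * K) ≤ x ^ (n - 1)) (n : ℕ) :
    DegreeBound d x n := by
  classical
  induction n using Nat.strong_induction_on with
  | _ n ih =>
  intro Ω _ G hcard hG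
  subst hcard
  set n := Fintype.card Ω with hn
  rcases lt_or_ge n d with hnd | hnd
  · refine le_trans ?_ (hsmall n hnd)
    have h1 := Subgroup.card_le_card_group G
    rw [Nat.card_perm, Nat.card_eq_fintype_card (α := Ω), ← hn] at h1
    exact_mod_cast h1
  by_cases hbot : G = ⊥
  · subst hbot
    simpa using one_le_pow₀ hx
  by_cases hprim : HasNoInvariantSetoid G
  · have hpre := isPreprimitive_of_hasNoInvariantSetoid hprim hbot
    have htrans := hpre.toIsPretransitive
    rcases le_or_gt (n ^ 2) (d ^ 3) with hmn | hln
    · obtain ⟨S, hS, hSc⟩ := exists_isBase_two_mul_card_le hpre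
        fun hA => hG (hasAltSection_of_alternatingGroup_le hA hnd)
      refine le_trans ?_ (hmid n hnd hmn _ hSc)
      exact_mod_cast hS.card_le
    · obtain ⟨hKn, v, k, l, hv, hvn, hk, hl, hbound⟩ := hlarge n hnd hln
      obtain ⟨Δ, hΔK, hΔ⟩ := exists_finset_small_orbits hG (hd.trans hnd) (ih K hKn) hK
      obtain ⟨S, hS, hSc⟩ := exists_isBase_card_le hprim (hd.trans hnd) hΔ hv hvn hk hl
      refine le_trans ?_ hbound
      have h1 : Nat.card G ≤ n ^ (k + l * K) := hS.card_le.trans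
        (Nat.pow_le_pow_right (by omega) (hSc.trans (by gcongr)))
      exact_mod_cast h1
  · simp only [HasNoInvariantSetoid] at hprim
    push Not at hprim
    obtain ⟨s, hs, hsb, hst⟩ := hprim
    exact card_le_of_invariant_setoid (by linarith) hG ih s hs hsb hst

end Bounds

section Estimates

open Real

theorem factorial_succ_le_pow (n : ℕ) : (n + 1).factorial ≤ (n + 1) ^ n := by
  induction n with
  | zero => simp
  | succ n ih =>
    calc (n + 1 + 1).factorial = (n + 1 + 1) * (n + 1).factorial := Nat.factorial_succ _
      _ ≤ (n + 1 + 1) * (n + 1 + 1) ^ n := by gcongr; exact ih.trans (by gcongr; simp)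
      _ = (n + 1 + 1) ^ (n + 1) := by ring

theorem exp_one_mul_pow_le (n : ℕ) : exp 1 * (n : ℝ) ^ (n + 1) ≤ ((n : ℝ) + 1) ^ (n + 1) := by
  have hn : (0 : ℝ) < (n : ℝ) + 1 := by positivity
  have h1 : exp ((n + 1 : ℕ) * (1 / ((n : ℝ) + 1))) = exp 1 := by
    congr 1
    push_cast
    field_simp
  rw [← h1, exp_nat_mul, ← mul_pow]
  refine pow_le_pow_left₀ (by positivity) ?_ _
  have h2 := one_sub_le_exp_neg (1 / ((n : ℝ) + 1))
  have h3 : 1 - 1 / ((n : ℝ) + 1) = n / (n + 1) := by field_simp; ring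
  rw [h3, exp_neg, ← one_div, div_le_div_iff₀ hn (exp_pos _)] at h2
  linarith

theorem factorial_succ_mul_exp_one_pow_le (n : ℕ) :
    ((n + 1).factorial : ℝ) * exp 1 ^ n ≤ ((n : ℝ) + 1) ^ (n + 2) := by
  induction n with
  | zero => simp
  | succ n ih =>
    have h := exp_one_mul_pow_le (n + 1)
    push_cast at h ⊢
    calc ((n + 1 + 1).factorial : ℝ) * exp 1 ^ (n + 1)
        = (n + 1 + 1) * (exp 1 * ((n + 1).factorial * exp 1 ^ n)) := by
          rw [Nat.factorial_succ (n + 1)]; push_cast; ring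
      _ ≤ (n + 1 + 1) * (exp 1 * ((n : ℝ) + 1) ^ (n + 2)) := by gcongr
      _ ≤ (n + 1 + 1) * ((n : ℝ) + 1 + 1) ^ (n + 2) := by gcongr
      _ = _ := by ring

theorem exists_factorial_le_pow {ε : ℝ} (hε : 0 < ε) :
    ∃ M : ℕ, ∀ d, M ≤ d → ∀ n < d,
      (n.factorial : ℝ) ≤ ((1 + ε) * d / exp 1) ^ (n - 1) := by
  have h := (tendsto_pow_const_div_const_pow_of_one_lt 2
    (by linarith : 1 < 1 + ε)).eventually_lt_const (by positivity : (0 : ℝ) < 1 / (1 + ε))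
  obtain ⟨N, hN⟩ := Filter.eventually_atTop.1 h
  refine ⟨3 * N, fun d hd n hnd => ?_⟩
  rcases n with _ | n
  · simp
  rw [Nat.add_sub_cancel]
  have he := exp_pos 1
  rcases lt_or_ge n N with hnN | hnN
  · have h1 : ((n + 1).factorial : ℝ) ≤ ((n : ℝ) + 1) ^ n := by
      exact_mod_cast factorial_succ_le_pow n
    refine h1.trans (pow_le_pow_left₀ (by positivity) ?_ _)
    rw [le_div_iff₀ he]
    have h2 : (3 : ℝ) * (n + 1) ≤ d := by exact_mod_cast (by omega : 3 * (n + 1) ≤ d)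
    have h3 := exp_one_lt_d9
    have hd0 : (0 : ℝ) ≤ d := by positivity
    nlinarith
  · have h1 := hN (n + 1) (by omega)
    rw [div_lt_div_iff₀ (by positivity) (by positivity), one_mul, pow_succ (1 + ε) n] at h1
    have h2 : ((n : ℝ) + 1) ^ 2 ≤ (1 + ε) ^ n := by
      have := lt_of_mul_lt_mul_right h1 (by positivity)
      push_cast at this
      exact this.le
    have h3 : (n : ℝ) + 1 ≤ d := by exact_mod_cast hnd.le
    rw [div_pow, le_div_iff₀ (by positivity)]
    calc ((n + 1).factorial : ℝ) * exp 1 ^ n ≤ ((n : ℝ) + 1) ^ (n + 2) :=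
          factorial_succ_mul_exp_one_pow_le n
      _ = ((n : ℝ) + 1) ^ 2 * (n + 1) ^ n := by ring
      _ ≤ (1 + ε) ^ n * d ^ n := by gcongr
      _ = _ := by rw [mul_pow]

theorem pow_le_pow_of_mul_log_le {a x : ℝ} (ha : 0 < a) (hx : 0 < x) {s m : ℕ}
    (h : s * log a ≤ m * log x) : a ^ s ≤ x ^ m := by
  rw [← log_le_log_iff (by positivity) (by positivity), log_pow, log_pow]
  exact h

theorem pow_le_pow_of_sq_le_cube {d n s : ℕ} {x : ℝ} (hd : 10 ≤ log d) (hx : d / exp 1 ≤ x)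
    (hdn : d ≤ n) (hnd : n ^ 2 ≤ d ^ 3) (hs : 2 * s ≤ n) : (n : ℝ) ^ s ≤ x ^ (n - 1) := by
  have hd0 : 0 < d := by
    rcases Nat.eq_zero_or_pos d with h | h
    · norm_num [h] at hd
    · exact h
  have hd' : (0 : ℝ) < d := by exact_mod_cast hd0
  have hn' : (0 : ℝ) < n := by exact_mod_cast hd0.trans_le hdn
  have hx0 : 0 < x := lt_of_lt_of_le (by positivity) hx
  refine pow_le_pow_of_mul_log_le hn' hx0 ?_
  have h1 : log d - 1 ≤ log x := by
    have := log_le_log (by positivity) hx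
    rwa [log_div hd'.ne' (exp_ne_zero 1), log_exp] at this
  have h2 : 2 * log n ≤ 3 * log d := by
    have : ((n : ℝ) ^ 2) ≤ d ^ 3 := by exact_mod_cast hnd
    have := log_le_log (by positivity) this
    simpa [log_pow] using this
  have h3 : log d ≤ n :=
    (log_le_self hd'.le).trans (by exact_mod_cast hdn)
  have h4 : (2 : ℝ) * s ≤ n := by exact_mod_cast hs
  have h5 : 0 ≤ log n := log_nonneg (by exact_mod_cast hd0.trans_le hdn)
  rw [Nat.cast_sub (by omega), Nat.cast_one]
  have h6 : s * log n ≤ n / 2 * (3 / 2 * log d) := by gcongr <;> linarith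
  have h7 : ((n : ℝ) - 1) * (log d - 1) ≤ (n - 1) * log x := by
    gcongr; linarith
  nlinarith

theorem two_pow_mul_pow_lt_factorial {d : ℕ} {x : ℝ} (hx : 1 ≤ x) (hd : 0 < d)
    (hxd : x ≤ 2 * d / exp 1) : 2 ^ (9 * d) * x ^ (9 * d - 1) < ((9 * d).factorial : ℝ) := by
  have h1 : (((9 * d : ℕ) : ℝ) / exp 1) ^ (9 * d) ≤ ((9 * d).factorial : ℝ) := by
    have h := pow_div_factorial_le_exp ((9 * d : ℕ) : ℝ) (by positivity) (9 * d)
    rw [div_pow, ← exp_nat_mul, mul_one]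
    rw [div_le_iff₀ (by positivity)] at h ⊢
    linarith
  refine lt_of_lt_of_le ?_ h1
  calc 2 ^ (9 * d) * x ^ (9 * d - 1) ≤ 2 ^ (9 * d) * x ^ (9 * d) := by
        gcongr
        omega
    _ = (2 * x) ^ (9 * d) := by rw [mul_pow]
    _ < _ := by
      refine pow_lt_pow_left₀ ?_ (by linarith) (by omega)
      have hd' : (0 : ℝ) < d := by exact_mod_cast hd
      have : 4 * d / exp 1 < ((9 * d : ℕ) : ℝ) / exp 1 := by
        gcongr
        push_cast
        linarith
      have h2 : 2 * (2 * d / exp 1) = 4 * d / exp 1 := by ring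
      linarith

theorem sq_mul_one_sub_pow_lt_one {n p : ℝ} (hn : 0 < n) (hp : p ≤ 1) {m : ℕ}
    (h : 2 * log n < p * m) : n ^ 2 * (1 - p) ^ m < 1 := by
  have h1 : (1 - p) ^ m ≤ exp (-(p * m)) := by
    refine (pow_le_pow_left₀ (by linarith) (one_sub_le_exp_neg p) m).trans (le_of_eq ?_)
    rw [← exp_nat_mul]
    congr 1
    ring
  have h2 : n ^ 2 = exp (2 * log n) := by
    rw [mul_comm, exp_mul, exp_log hn]
    norm_cast
  calc n ^ 2 * (1 - p) ^ m ≤ n ^ 2 * exp (-(p * m)) := by gcongr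
    _ = exp (2 * log n - p * m) := by rw [h2, ← exp_add]; ring_nf
    _ < 1 := by rw [exp_lt_one_iff]; linarith

theorem exists_separation_parameters :
    ∃ M : ℕ, ∀ d n : ℕ, M ≤ d → d ≤ n → d ^ 3 < n ^ 2 → ∀ x : ℝ, exp 1 ≤ x →
      ∃ (v : ℝ) (k l : ℕ), 1 ≤ v ∧ v ≤ n ∧
      (n : ℝ) ^ 2 * (1 - 1 / (2 * v)) ^ k < 1 ∧ (n : ℝ) ^ 2 * (1 - v / (6 * n)) ^ l < 1 ∧
      (n : ℝ) ^ (k + l * (9 * d)) ≤ x ^ (n - 1) := by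
  have hlog := ((isLittleO_log_rpow_rpow_atTop 2 (by norm_num : (0 : ℝ) < 1 / 6)).bound
    (by norm_num : (0 : ℝ) < 1 / 244)).and (Filter.eventually_ge_atTop (exp 1))
  obtain ⟨N, hN⟩ := Filter.eventually_atTop.1
    (tendsto_natCast_atTop_atTop.eventually hlog)
  refine ⟨N, fun d n hNd hdn hdn3 x hx => ?_⟩
  obtain ⟨hL, hne⟩ := hN n (hNd.trans hdn)
  set t : ℝ := (n : ℝ) ^ (1 / 6 : ℝ) with ht
  set L := log n with hLdef
  have hn0 : (0 : ℝ) < n := (exp_pos 1).trans_le hne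
  have hn2 : (2 : ℝ) ≤ n := by linarith [exp_one_gt_d9]
  have hL1 : 1 ≤ L := (le_log_iff_exp_le hn0).2 hne
  have ht0 : 0 < t := rpow_pos_of_pos hn0 _
  have hnt : (n : ℝ) = t ^ 6 := by
    rw [ht, ← rpow_natCast, ← rpow_mul hn0.le]
    norm_num
  have ht1 : 1 ≤ t := one_le_rpow (by linarith) (by norm_num)
  have hLt : 244 * L ^ 2 ≤ t := by
    rw [norm_of_nonneg ht0.le, norm_of_nonneg (by positivity), rpow_two] at hL
    linarith
  have hdt : (d : ℝ) ≤ t ^ 4 := by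
    have h : (d : ℝ) ^ 3 ≤ (t ^ 4) ^ 3 := by
      calc (d : ℝ) ^ 3 ≤ (n : ℝ) ^ 2 := by exact_mod_cast hdn3.le
        _ = _ := by rw [hnt]; ring
    exact le_of_pow_le_pow_left₀ (by norm_num) (by positivity) h
  have hk := Nat.lt_floor_add_one (4 * t ^ 5 * L)
  have hl := Nat.lt_floor_add_one (12 * t * L)
  have hk' := Nat.floor_le (by positivity : 0 ≤ 4 * t ^ 5 * L)
  have hl' := Nat.floor_le (by positivity : 0 ≤ 12 * t * L)
  have ht5 : 1 ≤ t ^ 5 := one_le_pow₀ ht1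
  refine ⟨t ^ 5, ⌊4 * t ^ 5 * L⌋₊ + 1, ⌊12 * t * L⌋₊ + 1, ht5, ?_, ?_, ?_, ?_⟩
  · rw [hnt]
    exact pow_le_pow_right₀ ht1 (by norm_num)
  · refine sq_mul_one_sub_pow_lt_one hn0 ?_ ?_
    · rw [div_le_one (by positivity)]
      linarith
    · rw [div_mul_eq_mul_div, lt_div_iff₀ (by positivity)]
      push_cast
      linarith
  · have h1 : t ^ 5 / (6 * n) = 1 / (6 * t) := by
      rw [hnt]
      field_simp
    rw [h1]
    refine sq_mul_one_sub_pow_lt_one hn0 ?_ ?_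
    · rw [div_le_one (by positivity)]
      linarith
    · rw [div_mul_eq_mul_div, lt_div_iff₀ (by positivity)]
      push_cast
      linarith
  · have hx0 := (exp_pos 1).trans_le hx
    refine pow_le_pow_of_mul_log_le hn0 hx0 ?_
    have hlx : 1 ≤ log x := (le_log_iff_exp_le hx0).2 hx
    have h1 : (((⌊4 * t ^ 5 * L⌋₊ + 1 + (⌊12 * t * L⌋₊ + 1) * (9 * d) : ℕ)) : ℝ) ≤
        4 * t ^ 5 * L + 1 + (12 * t * L + 1) * (9 * t ^ 4) := by
      push_cast
      gcongr
    have h2 : 4 * t ^ 5 * L + 1 + (12 * t * L + 1) * (9 * t ^ 4) ≤ 122 * t ^ 5 * L := by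
      have h3 : t ^ 5 * 1 ≤ t ^ 5 * L := by gcongr
      have h4 : t ^ 4 ≤ t ^ 5 := pow_le_pow_right₀ ht1 (by norm_num)
      linarith
    have h5 : 122 * t ^ 5 * L * L ≤ n / 2 := by
      have h6 : t ^ 5 * (244 * L ^ 2) ≤ t ^ 5 * t := by gcongr
      rw [hnt]
      linarith
    have h7 : ((n - 1 : ℕ) : ℝ) = n - 1 := by
      rw [Nat.cast_sub (by exact_mod_cast hn0), Nat.cast_one]
    calc _ ≤ 122 * t ^ 5 * L * L := by gcongr; exact h1.trans h2
      _ ≤ n / 2 := h5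
      _ ≤ ((n - 1 : ℕ) : ℝ) * 1 := by linarith
      _ ≤ _ := by gcongr

end Estimates

/-- **Proposition (Corollary 3(i)).** For every `ε > 0` there is `M(ε)` such that for all
`d ≥ M(ε)`: if `G ≤ Sym(Ω)` has degree `n` and `G ∈ Γ_d`, then `|G| ≤ ((1+ε)d/e)^{n-1}`. -/
theorem order_le_of_group_in_gamma (ε : ℝ) (hε : 0 < ε) :
    ∃ M : ℕ, ∀ d : ℕ, M ≤ d → ∀ (Ω : Type) [Fintype Ω],
      ∀ G : Subgroup (Equiv.Perm Ω), InGamma d ↥G →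
        (Nat.card ↥G : ℝ) ≤ ((1 + ε) * d / Real.exp 1) ^ (Fintype.card Ω - 1) := by
  obtain ⟨δ, hδ, hδ1, hδε⟩ : ∃ δ : ℝ, 0 < δ ∧ δ ≤ 1 ∧ δ ≤ ε :=
    ⟨min ε 1, by positivity, min_le_right _ _, min_le_left _ _⟩
  obtain ⟨M₁, hM₁⟩ := exists_factorial_le_pow hδ
  obtain ⟨M₂, hM₂⟩ := exists_separation_parameters
  refine ⟨max (max M₁ M₂) (max 82 ⌈Real.exp 10⌉₊), fun d hd Ω _ G hG => ?_⟩
  simp only [max_le_iff, Nat.ceil_le] at hd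
  obtain ⟨⟨hd₁, hd₂⟩, hd82, hd10⟩ := hd
  have he := Real.exp_pos 1
  have hd0 : (0 : ℝ) < d := (Real.exp_pos 10).trans_le hd10
  set x : ℝ := (1 + δ) * d / Real.exp 1 with hx
  have hdx : d / Real.exp 1 ≤ x := by
    rw [hx]
    gcongr
    nlinarith
  have hex : Real.exp 1 ≤ x := by
    refine le_trans ?_ hdx
    rw [le_div_iff₀ he, ← Real.exp_add]
    exact le_trans (Real.exp_le_exp.2 (by norm_num)) hd10
  have hx1 : 1 ≤ x := (Real.one_le_exp zero_le_one).trans hex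
  have hxd : x ≤ 2 * d / Real.exp 1 := by
    rw [hx]
    gcongr
    linarith
  have key := degreeBound_of_estimates hx1 (by omega) (hM₁ d hd₁)
    (fun n hdn hnd s hs => pow_le_pow_of_sq_le_cube
      ((Real.le_log_iff_exp_le hd0).2 hd10) hdx hdn hnd hs)
    (two_pow_mul_pow_lt_factorial hx1 (by omega) hxd)
    (fun n hdn hnd => ⟨by
      by_contra! h
      nlinarith [Nat.pow_le_pow_left h 2, Nat.mul_le_mul_right (d ^ 2) hd82],
      hM₂ d n hd₂ hdn hnd x hex⟩) (Fintype.card Ω) Ω G rfl hG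
  refine key.trans (pow_le_pow_left₀ (by linarith) ?_ _)
  rw [hx]
  gcongr
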